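/- Let G be a simple graph. If G admits a closed walk v₀ e₁ v₁ e₂ ⋯ e_n v_n with v_n = v₀ of length n ≥ 1 that is cyclically non-backtracking (i.e., e_{t+1} ≠ e_t for all 1 ≤ t < n and e_1 ≠ e_n), then G contains a cycle, and the girth of G is at most n. -/

import Mathlib

open Classical

/-- The mother matrix `H(a,b,c)` of an `(a,b,c)`-double-cylinder LDPC code:
an `((a+c-1)b) × ((a+c)b)` binary matrix (rows/columns indexed from 1 in the paper;
here `i : Fin ((a+c-1)*b)` represents row `i+1`, and similarly for columns). -/
noncomputable def motherMatrix (a b c : ℕ) :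
    Matrix (Fin ((a + c - 1) * b)) (Fin ((a + c) * b)) (ZMod 2) :=
  fun i j =>
    if (i.val / (a + c - 1) = j.val / (a + c) ∧
        ((i.val % (a + c - 1) < a ∧ j.val % (a + c) < a ∧
            ((((i.val % (a + c - 1) : ℤ)) - (j.val % (a + c) : ℤ)) % (a : ℤ) = 0 ∨
             (((i.val % (a + c - 1) : ℤ)) - (j.val % (a + c) : ℤ)) % (a : ℤ) = 1)) ∨
         (a - 1 ≤ i.val % (a + c - 1) ∧ a ≤ j.val % (a + c) ∧
            (((j.val % (a + c) : ℤ)) - (i.val % (a + c - 1) : ℤ) = 0 ∨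
             ((j.val % (a + c) : ℤ)) - (i.val % (a + c - 1) : ℤ) = 1)))) ∨
       (∃ k, 1 ≤ k ∧ k ≤ b ∧ j.val + 1 = (a + c) * k ∧
          (i.val + 1) % ((a + c - 1) * b) = ((a + c - 1) * k + 1) % ((a + c - 1) * b))
    then 1 else 0

/-- The `m`-lifting of a binary matrix `M` with shift assignment `s`:
each 1-entry of `M` is replaced by the `m × m` circulant permutation matrix
`I^{s(i,j)}`, and each 0-entry by the `m × m` zero matrix. -/
noncomputable def lifting {r n : ℕ} (M : Matrix (Fin r) (Fin n) (ZMod 2)) (m : ℕ)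
    (s : Fin r × Fin n → ZMod m) :
    Matrix (Fin r × ZMod m) (Fin n × ZMod m) (ZMod 2) :=
  fun p q => if M p.1 q.1 = 1 ∧ p.2 - q.2 = s (p.1, q.1) then 1 else 0

/-- The Tanner graph of a binary matrix `H`: the bipartite simple graph on
check nodes (rows, `Sum.inl`) and bit nodes (columns, `Sum.inr`), with
check node `i` adjacent to bit node `j` iff `H i j = 1`. -/
def tannerGraph {α β : Type*} (H : Matrix α β (ZMod 2)) : SimpleGraph (α ⊕ β) where
  Adj x y :=
    (∃ i j, x = Sum.inl i ∧ y = Sum.inr j ∧ H i j = 1) ∨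
    (∃ i j, x = Sum.inr j ∧ y = Sum.inl i ∧ H i j = 1)
  symm := by
    constructor
    rintro x y (⟨i, j, rfl, rfl, h⟩ | ⟨i, j, rfl, rfl, h⟩)
    · exact Or.inr ⟨i, j, rfl, rfl, h⟩
    · exact Or.inl ⟨i, j, rfl, rfl, h⟩
  loopless := by
    constructor
    rintro x (⟨i, j, h1, h2, _⟩ | ⟨i, j, h1, h2, _⟩) <;> simp_all

/-- `G` has a cyclically non-backtracking closed walk of length `L`:
a closed walk `v₀ e₁ v₁ ⋯ e_n v_n` with `v_n = v₀`, `n = L`, in which no two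
consecutive edges coincide (`e_{t+1} ≠ e_t` for `1 ≤ t < n`) and the first and
last edges differ (`e₁ ≠ e_n`). -/
def HasCNBClosedWalk {V : Type*} (G : SimpleGraph V) (L : ℕ) : Prop :=
  ∃ (v : V) (w : G.Walk v v), w.length = L ∧
    w.edges.Chain' (· ≠ ·) ∧ w.edges.head? ≠ w.edges.getLast?

/-- A closed non-backtracking walk of positive length has a cycle among its edges. -/
theorem SimpleGraph.Walk.exists_isCycle_length_le_of_isChain {V : Type*} {G : SimpleGraph V}
    {v : V} (w : G.Walk v v) (hnil : ¬ w.Nil) (hchain : w.edges.IsChain (· ≠ ·)) :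
    ∃ (u : V) (c : G.Walk u u), c.IsCycle ∧ c.length ≤ w.length := by
  let H := SimpleGraph.fromEdgeSet {e | e ∈ w.edges}
  have hedge : ∀ e ∈ w.edges, e ∈ H.edgeSet := fun e he => by
    rw [SimpleGraph.edgeSet_fromEdgeSet]
    exact ⟨he, G.not_isDiag_of_mem_edgeSet (w.edges_subset_edgeSet he)⟩
  have hmem : ∀ e ∈ H.edgeSet, e ∈ w.edges := fun e he => by
    rw [SimpleGraph.edgeSet_fromEdgeSet] at he
    exact he.1
  have hH : ¬ H.IsAcyclic := fun hac => by
    have hpath : (w.transfer H hedge).IsPath :=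
      (hac.isPath_iff_isChain _).2 (by rwa [SimpleGraph.Walk.edges_transfer])
    have hlen := SimpleGraph.Walk.length_eq_zero_iff.2 (SimpleGraph.Walk.isPath_iff_nil.1 hpath)
    rw [SimpleGraph.Walk.length_transfer] at hlen
    exact hnil (SimpleGraph.Walk.length_eq_zero_iff.1 hlen)
  simp only [SimpleGraph.IsAcyclic, not_forall, not_not] at hH
  obtain ⟨u, c, hc⟩ := hH
  have hsub : c.edges ⊆ w.edges := fun e he => hmem e (c.edges_subset_edgeSet he)
  refine ⟨u, c.transfer G fun e he => w.edges_subset_edgeSet (hsub he), hc.transfer _, ?_⟩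
  rw [SimpleGraph.Walk.length_transfer, ← c.length_edges, ← w.length_edges]
  exact (hc.edges_nodup.subperm hsub).length_le

/-- If a simple graph `G` admits a closed walk of length `n ≥ 1` that is
cyclically non-backtracking (no edge immediately repeated, including across the closure
point), then `G` contains a cycle and the girth of `G` is at most `n`. -/
theorem girth_le_of_cnb_closed_walk {V : Type*} (G : SimpleGraph V) (v : V)
    (w : G.Walk v v) (hlen : 1 ≤ w.length)
    (hchain : w.edges.Chain' (· ≠ ·))
    (hclosure : w.edges.head? ≠ w.edges.getLast?) :
    (∃ (u : V) (cyc : G.Walk u u), cyc.IsCycle) ∧ G.girth ≤ (w.length : ℕ∞) := by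
  obtain ⟨u, c, hc, hle⟩ := w.exists_isCycle_length_le_of_isChain
    (fun h => by simp [SimpleGraph.Walk.length_eq_zero_iff.2 h] at hlen) hchain
  exact ⟨⟨u, c, hc⟩, by exact_mod_cast (SimpleGraph.girth_le_length hc).trans hle⟩
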